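/- (DAgger-style update, intermediate bound.) Let π_n, π_{n+1}, η_n be policies with E_{s∼d_{π_n}}[D_TV(π_{n+1}(·|s), π_n(·|s))] ≤ β for some β ≥ 0. Fix a selection a*(s) ∈ argmin_{a∈A} A^{η_n}(s,a) for each state s, and suppose E_{s∼d_{π_n}}[E_{a∼π_{n+1}(·|s)}[1(a ≠ a*(s))]] ≤ ε_n. Define ε' = max_{s,a} A^{η_n}(s,a), ε = max_{s∈S} |E_{a∼π_{n+1}(·|s)}[A^{η_n}(s,a)]|, and assume ε' ≥ 0 and A^{η_n}(s, a*(s)) ≤ 0 for every s. Then (1−γ)·(J(π_{n+1}) − J(η_n)) ≤ ε'·ε_n + 2βε/(1−γ). -/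

import Mathlib

open scoped BigOperators

noncomputable section

/-- `p` is a probability distribution on a finite type. -/
def IsDist {X : Type*} [Fintype X] (p : X → ℝ) : Prop :=
  (∀ x, 0 ≤ p x) ∧ ∑ x, p x = 1

/-- `P` is a transition dynamics: `P s a` is a distribution over next states. -/
def IsDynamics {S A : Type*} [Fintype S] (P : S → A → S → ℝ) : Prop :=
  ∀ s a, IsDist (P s a)

/-- `π` is a (stochastic) policy: `π s` is a distribution over actions. -/
def IsPolicy {S A : Type*} [Fintype A] (π : S → A → ℝ) : Prop :=
  ∀ s, IsDist (π s)

/-- One-step evolution of a state distribution under policy `π` and dynamics `P`. -/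
def step {S A : Type*} [Fintype S] [Fintype A]
    (P : S → A → S → ℝ) (π : S → A → ℝ) (d : S → ℝ) : S → ℝ :=
  fun s' => ∑ s, ∑ a, d s * π s a * P s a s'

/-- The time-`t` state distribution `d_π^t` starting from `ρ₀`. -/
def stateDist {S A : Type*} [Fintype S] [Fintype A]
    (P : S → A → S → ℝ) (π : S → A → ℝ) (ρ₀ : S → ℝ) : ℕ → S → ℝ
  | 0 => ρ₀
  | t + 1 => step P π (stateDist P π ρ₀ t)

/-- Discounted state visitation distribution `d_π = (1-γ) Σ_t γ^t d_π^t`. -/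
def visit {S A : Type*} [Fintype S] [Fintype A]
    (γ : ℝ) (P : S → A → S → ℝ) (π : S → A → ℝ) (ρ₀ : S → ℝ) : S → ℝ :=
  fun s => (1 - γ) * ∑' t : ℕ, γ ^ t * stateDist P π ρ₀ t s

/-- Expected cost of one step when the state is distributed as `d` and actions follow `π`. -/
def expCost {S A : Type*} [Fintype S] [Fintype A]
    (c : S → A → ℝ) (π : S → A → ℝ) (d : S → ℝ) : ℝ :=
  ∑ s, ∑ a, d s * π s a * c s a

/-- Value function `V^π(s₀)`: expected total discounted cost starting at `s₀`. -/
def Vf {S A : Type*} [Fintype S] [Fintype A] [DecidableEq S]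
    (γ : ℝ) (P : S → A → S → ℝ) (c : S → A → ℝ) (π : S → A → ℝ) (s₀ : S) : ℝ :=
  ∑' t : ℕ, γ ^ t * expCost c π (stateDist P π (fun s => if s = s₀ then 1 else 0) t)

/-- Objective `J(π) = E_{s∼ρ₀}[V^π(s)]`. -/
def Jf {S A : Type*} [Fintype S] [Fintype A] [DecidableEq S]
    (γ : ℝ) (P : S → A → S → ℝ) (c : S → A → ℝ) (ρ₀ : S → ℝ) (π : S → A → ℝ) : ℝ :=
  ∑ s, ρ₀ s * Vf γ P c π s

/-- State-action value `Q^π(s,a) = c(s,a) + γ E_{s'∼P_{s,a}}[V^π(s')]`. -/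
def Qf {S A : Type*} [Fintype S] [Fintype A] [DecidableEq S]
    (γ : ℝ) (P : S → A → S → ℝ) (c : S → A → ℝ) (π : S → A → ℝ) (s : S) (a : A) : ℝ :=
  c s a + γ * ∑ s', P s a s' * Vf γ P c π s'

/-- Disadvantage function `A^π(s,a) = Q^π(s,a) - V^π(s)`. -/
def Adv {S A : Type*} [Fintype S] [Fintype A] [DecidableEq S]
    (γ : ℝ) (P : S → A → S → ℝ) (c : S → A → ℝ) (π : S → A → ℝ) (s : S) (a : A) : ℝ :=
  Qf γ P c π s a - Vf γ P c π s

section Helpers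

variable {S A : Type*} [Fintype S] [Fintype A]

/-- Exchanging the order of summation: pairing `step P π d` with a function on states. -/
lemma sum_step_mul (P : S → A → S → ℝ) (π : S → A → ℝ) (d f : S → ℝ) :
    ∑ s', step P π d s' * f s' = ∑ s, d s * ∑ a, π s a * ∑ s', P s a s' * f s' := by
  simp only [step, Finset.sum_mul, Finset.mul_sum]
  rw [Finset.sum_comm]
  refine Finset.sum_congr rfl fun s _ => ?_
  rw [Finset.sum_comm]
  exact Finset.sum_congr rfl fun a _ => Finset.sum_congr rfl fun s' _ => by ring

lemma IsDist.step {P : S → A → S → ℝ} {π : S → A → ℝ} {d : S → ℝ}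
    (hd : IsDist d) (hP : IsDynamics P) (hπ : IsPolicy π) : IsDist (step P π d) := by
  refine ⟨fun s' => Finset.sum_nonneg fun s _ => Finset.sum_nonneg fun a _ =>
    mul_nonneg (mul_nonneg (hd.1 s) ((hπ s).1 a)) ((hP s a).1 s'), ?_⟩
  have h := sum_step_mul P π d (fun _ => 1)
  simpa [(hP _ _).2, (hπ _).2, hd.2] using h

lemma IsDist.stateDist {P : S → A → S → ℝ} {π : S → A → ℝ} {ρ : S → ℝ}
    (hρ : IsDist ρ) (hP : IsDynamics P) (hπ : IsPolicy π) (t : ℕ) :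
    IsDist (stateDist P π ρ t) := by
  induction t with
  | zero => exact hρ
  | succ t ih => exact ih.step hP hπ

lemma IsDist.le_one {X : Type*} [Fintype X] {p : X → ℝ} (hp : IsDist p) (x : X) : p x ≤ 1 :=
  hp.2 ▸ Finset.single_le_sum (fun y _ => hp.1 y) (Finset.mem_univ x)

lemma isDist_pointMass {X : Type*} [Fintype X] [DecidableEq X] (x₀ : X) :
    IsDist (fun x => if x = x₀ then (1 : ℝ) else 0) :=
  ⟨fun x => by dsimp only; split_ifs <;> norm_num, by simp⟩

lemma summable_stateDist {γ : ℝ} {P : S → A → S → ℝ} {π : S → A → ℝ} {ρ : S → ℝ}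
    (hγ : 0 ≤ γ) (hγ' : γ < 1) (hP : IsDynamics P) (hπ : IsPolicy π) (hρ : IsDist ρ) (s : S) :
    Summable fun t : ℕ => γ ^ t * stateDist P π ρ t s :=
  (summable_geometric_of_lt_one hγ hγ').of_nonneg_of_le
    (fun t => mul_nonneg (pow_nonneg hγ t) ((hρ.stateDist hP hπ t).1 s))
    (fun t => mul_le_of_le_one_right (pow_nonneg hγ t) ((hρ.stateDist hP hπ t).le_one s))

/-- The visitation measure computes discounted sums of linear functionals of `d_π^t`. -/
lemma hasSum_visit {γ : ℝ} {P : S → A → S → ℝ} {π : S → A → ℝ} {ρ : S → ℝ}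
    (hγ : 0 ≤ γ) (hγ' : γ < 1) (hP : IsDynamics P) (hπ : IsPolicy π) (hρ : IsDist ρ)
    (f : S → ℝ) :
    HasSum (fun t : ℕ => (1 - γ) * (γ ^ t * ∑ s, stateDist P π ρ t s * f s))
      (∑ s, visit γ P π ρ s * f s) := by
  have h := hasSum_sum (s := Finset.univ) fun s _ =>
    ((summable_stateDist hγ hγ' hP hπ hρ s).hasSum.mul_left (1 - γ)).mul_right (f s)
  have hfun : (fun t : ℕ => (1 - γ) * (γ ^ t * ∑ s, stateDist P π ρ t s * f s)) =
      fun t => ∑ s, (1 - γ) * (γ ^ t * stateDist P π ρ t s) * f s := by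
    funext t
    simp only [Finset.mul_sum, mul_assoc]
  rw [hfun]
  exact h

lemma visit_nonneg {γ : ℝ} {P : S → A → S → ℝ} {π : S → A → ℝ} {ρ : S → ℝ}
    (hγ : 0 ≤ γ) (hγ' : γ < 1) (hP : IsDynamics P) (hπ : IsPolicy π) (hρ : IsDist ρ) (s : S) :
    0 ≤ visit γ P π ρ s :=
  mul_nonneg (by linarith) (tsum_nonneg fun t =>
    mul_nonneg (pow_nonneg hγ t) ((hρ.stateDist hP hπ t).1 s))

/-- The Bellman flow equation `d_π = (1-γ) ρ₀ + γ (step d_π)`. -/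
lemma visit_eq_add_step {γ : ℝ} {P : S → A → S → ℝ} {π : S → A → ℝ} {ρ : S → ℝ}
    (hγ : 0 ≤ γ) (hγ' : γ < 1) (hP : IsDynamics P) (hπ : IsPolicy π) (hρ : IsDist ρ) (s' : S) :
    visit γ P π ρ s' = (1 - γ) * ρ s' + γ * step P π (visit γ P π ρ) s' := by
  have hstep : ∀ d : S → ℝ, step P π d s' = ∑ s, d s * ∑ a, π s a * P s a s' := fun d => by
    simp only [step, Finset.mul_sum, mul_assoc]
  have h := (hasSum_visit hγ hγ' hP hπ hρ fun s => ∑ a, π s a * P s a s').tsum_eq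
  rw [hstep, ← h, visit, (summable_stateDist hγ hγ' hP hπ hρ s').tsum_eq_zero_add, mul_add,
    ← tsum_mul_left, ← tsum_mul_left]
  congr 1
  · simp [stateDist]
  · refine tsum_congr fun t => ?_
    rw [← hstep, stateDist]
    ring

lemma stateDist_eq_sum [DecidableEq S] (P : S → A → S → ℝ) (π : S → A → ℝ) (ρ : S → ℝ) (t : ℕ)
    (s : S) :
    stateDist P π ρ t s =
      ∑ s₀, ρ s₀ * stateDist P π (fun x => if x = s₀ then 1 else 0) t s := by
  induction t generalizing s with
  | zero => simp [stateDist]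
  | succ t ih =>
    simp only [stateDist, step, ih, Finset.sum_mul, Finset.mul_sum]
    rw [Finset.sum_comm]
    conv_rhs => rw [Finset.sum_comm]; enter [2, s]; rw [Finset.sum_comm]
    rw [Finset.sum_comm]
    exact Finset.sum_congr rfl fun _ _ => Finset.sum_congr rfl fun _ _ =>
      Finset.sum_congr rfl fun _ _ => by ring

lemma expCost_eq (c : S → A → ℝ) (π : S → A → ℝ) (d : S → ℝ) :
    expCost c π d = ∑ s, d s * ∑ a, π s a * c s a := by
  simp only [expCost, Finset.mul_sum, mul_assoc]

/-- The objective is the expected cost under the visitation distribution. -/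
lemma one_sub_mul_Jf [DecidableEq S] {γ : ℝ} {P : S → A → S → ℝ} {π : S → A → ℝ} {ρ : S → ℝ}
    (hγ : 0 ≤ γ) (hγ' : γ < 1) (hP : IsDynamics P) (hπ : IsPolicy π) (hρ : IsDist ρ)
    (c : S → A → ℝ) :
    (1 - γ) * Jf γ P c ρ π = expCost c π (visit γ P π ρ) := by
  have hpos : 1 - γ ≠ 0 := by linarith
  rw [expCost_eq, ← (hasSum_visit hγ hγ' hP hπ hρ _).tsum_eq, Jf, tsum_mul_left]
  congr 1
  simp only [Vf]
  have hsum : ∀ s₀ : S, Summable fun t : ℕ =>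
      ρ s₀ * (γ ^ t * expCost c π (stateDist P π (fun x => if x = s₀ then 1 else 0) t)) := by
    intro s₀
    have h := (hasSum_visit hγ hγ' hP hπ (isDist_pointMass s₀) fun s => ∑ a, π s a * c s a).summable
    rw [summable_mul_left_iff hpos] at h
    simpa only [expCost_eq] using h.mul_left (ρ s₀)
  simp only [← tsum_mul_left]
  rw [← Summable.tsum_finsetSum fun s₀ _ => hsum s₀]
  refine tsum_congr fun t => ?_
  simp only [stateDist_eq_sum P π ρ t, expCost_eq, Finset.sum_mul, Finset.mul_sum (a := γ ^ t)]
  rw [Finset.sum_comm]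
  refine Finset.sum_congr rfl fun s₀ _ => ?_
  rw [Finset.mul_sum]
  exact Finset.sum_congr rfl fun s _ => by ring

/-- The performance difference lemma. -/
lemma performance_difference [DecidableEq S] {γ : ℝ} {P : S → A → S → ℝ} {π : S → A → ℝ}
    {ρ : S → ℝ} (hγ : 0 ≤ γ) (hγ' : γ < 1) (hP : IsDynamics P) (hπ : IsPolicy π)
    (hρ : IsDist ρ) (c : S → A → ℝ) (η : S → A → ℝ) :
    (1 - γ) * (Jf γ P c ρ π - Jf γ P c ρ η) =
      ∑ s, visit γ P π ρ s * ∑ a, π s a * Adv γ P c η s a := by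
  have hA : ∀ s, ∑ a, π s a * Adv γ P c η s a = ∑ a, π s a * c s a +
      γ * ∑ a, π s a * ∑ s', P s a s' * Vf γ P c η s' - Vf γ P c η s := by
    intro s
    have h1 : Vf γ P c η s = ∑ a, π s a * Vf γ P c η s := by
      rw [← Finset.sum_mul, (hπ s).2, one_mul]
    conv_rhs => rw [h1]
    rw [Finset.mul_sum, ← Finset.sum_add_distrib, ← Finset.sum_sub_distrib]
    exact Finset.sum_congr rfl fun a _ => by rw [Adv, Qf]; ring
  have hflow : ∑ s, visit γ P π ρ s * Vf γ P c η s = (1 - γ) * Jf γ P c ρ η +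
      γ * ∑ s, step P π (visit γ P π ρ) s * Vf γ P c η s := by
    rw [Jf, Finset.mul_sum, Finset.mul_sum, ← Finset.sum_add_distrib]
    refine Finset.sum_congr rfl fun s _ => ?_
    conv_lhs => rw [visit_eq_add_step hγ hγ' hP hπ hρ s]
    ring
  rw [sum_step_mul] at hflow
  simp only [hA, mul_sub, mul_add, Finset.sum_sub_distrib, Finset.sum_add_distrib]
  rw [hflow, one_sub_mul_Jf hγ hγ' hP hπ hρ, expCost_eq, Finset.mul_sum (a := γ)]
  simp only [mul_left_comm γ]
  ring

/-- The `ℓ¹` distance between visitation distributions is controlled by the expected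
total variation distance between the policies. -/
lemma sum_abs_visit_sub_le {γ : ℝ} {P : S → A → S → ℝ} {π π' : S → A → ℝ} {ρ : S → ℝ}
    (hγ : 0 ≤ γ) (hγ' : γ < 1) (hP : IsDynamics P) (hπ : IsPolicy π) (hπ' : IsPolicy π')
    (hρ : IsDist ρ) :
    (1 - γ) * ∑ s, |visit γ P π' ρ s - visit γ P π ρ s| ≤
      γ * ∑ s, visit γ P π ρ s * ∑ a, |π' s a - π s a| := by
  set d := visit γ P π ρ with hd
  set d' := visit γ P π' ρ with hd'
  have hdiff : ∀ s', |d' s' - d s'| ≤ γ * (step P π' (fun s => |d' s - d s|) s' +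
      step P (fun s a => |π' s a - π s a|) d s') := by
    intro s'
    have h : d' s' - d s' = γ * (∑ s, ∑ a, (d' s - d s) * π' s a * P s a s' +
        ∑ s, ∑ a, d s * (π' s a - π s a) * P s a s') := by
      rw [hd, hd', visit_eq_add_step hγ hγ' hP hπ hρ s', visit_eq_add_step hγ hγ' hP hπ' hρ s',
        ← hd, ← hd', add_sub_add_left_eq_sub, ← mul_sub, step, step, ← Finset.sum_sub_distrib,
        ← Finset.sum_add_distrib]
      simp only [← Finset.sum_sub_distrib, ← Finset.sum_add_distrib]
      congr 1
      exact Finset.sum_congr rfl fun s _ => Finset.sum_congr rfl fun a _ => by ring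
    rw [h, abs_mul, abs_of_nonneg hγ]
    refine mul_le_mul_of_nonneg_left ((abs_add_le _ _).trans (add_le_add ?_ ?_)) hγ
    · refine (Finset.abs_sum_le_sum_abs _ _).trans (Finset.sum_le_sum fun s _ =>
        (Finset.abs_sum_le_sum_abs _ _).trans (Finset.sum_le_sum fun a _ => ?_))
      rw [abs_mul, abs_mul, abs_of_nonneg ((hπ' s).1 a), abs_of_nonneg ((hP s a).1 s')]
    · refine (Finset.abs_sum_le_sum_abs _ _).trans (Finset.sum_le_sum fun s _ =>
        (Finset.abs_sum_le_sum_abs _ _).trans (Finset.sum_le_sum fun a _ => ?_))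
      rw [abs_mul, abs_mul, abs_of_nonneg (visit_nonneg hγ hγ' hP hπ hρ s),
        abs_of_nonneg ((hP s a).1 s')]
  have hmass : ∀ (p : S → A → ℝ) (q : S → ℝ), ∑ s', step P p q s' = ∑ s, q s * ∑ a, p s a :=
    fun p q => by simpa [(hP _ _).2] using sum_step_mul P p q (fun _ => 1)
  have hsum := Finset.sum_le_sum fun s' (_ : s' ∈ Finset.univ) => hdiff s'
  rw [← Finset.mul_sum, Finset.sum_add_distrib, hmass, hmass] at hsum
  simp only [(hπ' _).2, mul_one] at hsum
  linarith

end Helpers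

/-- **DAgger-style update, intermediate bound.** With `a*(s)` a pointwise minimizer of
`A^{η_n}(s,·)`, classification error at most `ε_n`, `ε' = max_{s,a} A^{η_n}(s,a) ≥ 0`,
`ε = max_s |E_{a∼π_{n+1}(·|s)}[A^{η_n}(s,a)]|`, and trust region radius `β`, we have
`(1-γ)(J(π_{n+1}) - J(η_n)) ≤ ε'·ε_n + 2βε/(1-γ)`. -/
theorem dagger_intermediate_bound
    {S A : Type*} [Fintype S] [Fintype A] [Nonempty S] [Nonempty A]
    [DecidableEq S] [DecidableEq A]
    (γ : ℝ) (P : S → A → S → ℝ) (c : S → A → ℝ) (ρ₀ : S → ℝ)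
    (hγ : 0 < γ) (hγ' : γ < 1) (hP : IsDynamics P) (hρ : IsDist ρ₀)
    (hc : ∀ s a, 0 ≤ c s a ∧ c s a ≤ 1)
    (πn πnext ηn : S → A → ℝ)
    (hπn : IsPolicy πn) (hπnext : IsPolicy πnext) (hηn : IsPolicy ηn)
    (β εn : ℝ) (hβ : 0 ≤ β) (hεn : 0 ≤ εn)
    (htv : ∑ s, visit γ P πn ρ₀ s * ((∑ a, |πnext s a - πn s a|) / 2) ≤ β)
    (astar : S → A)
    (hastar : ∀ s a, Adv γ P c ηn s (astar s) ≤ Adv γ P c ηn s a)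
    (hclass : ∑ s, visit γ P πn ρ₀ s *
      ∑ a, πnext s a * (if a = astar s then (0 : ℝ) else 1) ≤ εn)
    (hε' : 0 ≤ ⨆ s : S, ⨆ a : A, Adv γ P c ηn s a)
    (hneg : ∀ s, Adv γ P c ηn s (astar s) ≤ 0) :
    (1 - γ) * (Jf γ P c ρ₀ πnext - Jf γ P c ρ₀ ηn) ≤
      (⨆ s : S, ⨆ a : A, Adv γ P c ηn s a) * εn +
        2 * β * (⨆ s : S, |∑ a, πnext s a * Adv γ P c ηn s a|) / (1 - γ) := by
  set d := visit γ P πn ρ₀ with hd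
  set d' := visit γ P πnext ρ₀ with hd'
  set g : S → ℝ := fun s => ∑ a, πnext s a * Adv γ P c ηn s a with hg
  set M := ⨆ s : S, ⨆ a : A, Adv γ P c ηn s a with hM
  set E := ⨆ s : S, |g s| with hE
  have hd0 : ∀ s, 0 ≤ d s := visit_nonneg hγ.le hγ' hP hπn hρ
  have hAM : ∀ s a, Adv γ P c ηn s a ≤ M := fun s a =>
    (le_ciSup (f := fun a => Adv γ P c ηn s a) (Set.finite_range _).bddAbove a).trans
      (le_ciSup (f := fun s => ⨆ a, Adv γ P c ηn s a) (Set.finite_range _).bddAbove s)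
  have hgE : ∀ s, |g s| ≤ E := fun s =>
    le_ciSup (f := fun s => |g s|) (Set.finite_range _).bddAbove s
  have hE0 : 0 ≤ E := Real.iSup_nonneg fun s => abs_nonneg _
  have hgM : ∀ s, g s ≤ M * ∑ a, πnext s a * (if a = astar s then (0 : ℝ) else 1) := by
    intro s
    rw [Finset.mul_sum]
    refine Finset.sum_le_sum fun a _ => ?_
    split_ifs with h
    · simpa [h] using mul_nonpos_of_nonneg_of_nonpos ((hπnext s).1 (astar s)) (hneg s)
    · nlinarith [mul_le_mul_of_nonneg_left (hAM s a) ((hπnext s).1 a)]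
  have hon : ∑ s, d s * g s ≤ M * εn := by
    refine le_trans ?_ (mul_le_mul_of_nonneg_left hclass hε')
    rw [Finset.mul_sum]
    refine Finset.sum_le_sum fun s _ => ?_
    rw [mul_left_comm]
    exact mul_le_mul_of_nonneg_left (hgM s) (hd0 s)
  have hshift : ∑ s, d' s * g s - ∑ s, d s * g s ≤ E * ∑ s, |d' s - d s| := by
    rw [← Finset.sum_sub_distrib, Finset.mul_sum]
    refine Finset.sum_le_sum fun s _ => ?_
    rw [← sub_mul, mul_comm E]
    exact (le_abs_self _).trans ((abs_mul _ _).trans_le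
      (mul_le_mul_of_nonneg_left (hgE s) (abs_nonneg _)))
  have hl1 : ∑ s, |d' s - d s| ≤ 2 * β / (1 - γ) := by
    rw [le_div_iff₀ (by linarith), mul_comm]
    have h2 : ∑ s, d s * ∑ a, |πnext s a - πn s a| ≤ 2 * β := by
      simp only [← mul_div_assoc, ← Finset.sum_div] at htv
      linarith
    have h0 : 0 ≤ ∑ s, d s * ∑ a, |πnext s a - πn s a| := Finset.sum_nonneg fun s _ =>
      mul_nonneg (hd0 s) (Finset.sum_nonneg fun a _ => abs_nonneg _)
    exact (sum_abs_visit_sub_le hγ.le hγ' hP hπn hπnext hρ).trans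
      ((mul_le_of_le_one_left h0 hγ'.le).trans h2)
  rw [performance_difference hγ.le hγ' hP hπnext hρ]
  calc ∑ s, d' s * g s ≤ ∑ s, d s * g s + E * ∑ s, |d' s - d s| := by linarith
    _ ≤ M * εn + E * (2 * β / (1 - γ)) :=
      add_le_add hon (mul_le_mul_of_nonneg_left hl1 hE0)
    _ = M * εn + 2 * β * E / (1 - γ) := by ring
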